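/- Future asymptotics of generic scalar-field modes on the LRS vacuum Bianchi VIII solution in proper time: let l > 0, μ ∈ ℝ, m a nonzero integer, Λ ≥ 0, f(t) = t² − l² + 2μt, Z_m(t) = (m²/(4l²))·((t²+l²)/f(t))² + (m²+Λ)/f(t), U(t) = (t² − l² + 2μt)/(t² + l²), and let τ(t) = ∫_{t₀}^{t} U(s)^{−1/2} ds for t ≥ t₀, where t₀ is chosen so that f > 0 and U > 0 on [t₀,∞). Then for each sign ε ∈ {+1,−1} there exist a twice differentiable function ψ : (t₀,∞) → ℂ solving ψ''(t) + (f'(t)/f(t))·ψ'(t) + Z_m(t)·ψ(t) = 0 on (t₀,∞) and a nonzero constant c ∈ ℂ such that lim_{t→∞} ψ(t) · τ(t) · exp(−ε·i·(|m|/(2l))·(τ(t) − μ·log τ(t))) = c; i.e. expressed in proper time τ the fundamental solutions behave as τ^{−1} e^{±i|m/(2l)|(τ − μ log τ)}(1 + o(1)) up to a nonzero constant factor. Note that in proper time the logarithmic phase coefficient is −μ, half of the coefficient −2μ appearing in the coordinate-time expression t − 2μ log t. -/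

import Mathlib

noncomputable section

open Set Filter

section
open MeasureTheory Topology

variable {E : Type*} [NormedAddCommGroup E] [NormedSpace ℝ E]

theorem integral_Ioi_eq_sub_intervalIntegral {g : ℝ → E} (hi : Integrable g) (t : ℝ) :
    ∫ s in Ioi t, g s = (∫ s in Ioi (0 : ℝ), g s) - ∫ s in (0 : ℝ)..t, g s :=
  eq_sub_of_add_eq' (intervalIntegral.integral_interval_add_Ioi hi.integrableOn hi.integrableOn)

theorem tendsto_integral_Ioi_atTop {g : ℝ → E} (hi : Integrable g) :
    Tendsto (fun t => ∫ s in Ioi t, g s) atTop (𝓝 0) := by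
  rw [funext (integral_Ioi_eq_sub_intervalIntegral hi)]
  simpa using (intervalIntegral_tendsto_integral_Ioi (0 : ℝ) hi.integrableOn
    tendsto_id).const_sub (∫ s in Ioi (0 : ℝ), g s)

variable [CompleteSpace E]

theorem hasDerivAt_integral_Ioi {g : ℝ → E} (hc : Continuous g) (hi : Integrable g) (t : ℝ) :
    HasDerivAt (fun t => ∫ s in Ioi t, g s) (-g t) t := by
  rw [funext (integral_Ioi_eq_sub_intervalIntegral hi)]
  exact (hc.integral_hasStrictDerivAt 0 t).hasDerivAt.const_sub _

/-- A differential equation `x' = F t x` whose right-hand side is Lipschitz in `x` with an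
integrable Lipschitz constant `φ t`, and vanishes at `x = 0`, has a global solution with
any prescribed limit at `+∞`. -/
theorem exists_solution_tendsto_atTop {F : ℝ → E → E} {φ : ℝ → ℝ}
    (hF : Continuous (Function.uncurry F)) (hφc : Continuous φ) (hφi : Integrable φ)
    (hF0 : ∀ t, F t 0 = 0) (hLip : ∀ t x y, ‖F t x - F t y‖ ≤ φ t * ‖x - y‖) (v : E) :
    ∃ x : ℝ → E, (∀ t, HasDerivAt x (F t (x t)) t) ∧ Tendsto x atTop (𝓝 v) := by
  rcases subsingleton_or_nontrivial E with hE | hE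
  · exact ⟨fun _ => v, fun t => by
      rw [Subsingleton.elim (F t v) 0]; exact hasDerivAt_const t v, tendsto_const_nhds⟩
  obtain ⟨w, hw⟩ := exists_ne (0 : E)
  have hφ0 (t : ℝ) : 0 ≤ φ t := by
    have := (norm_nonneg _).trans (hLip t w 0)
    exact nonneg_of_mul_nonneg_left this (by simpa using hw)
  set Φ : ℝ → ℝ := fun t => ∫ s in Ioi t, φ s with hΦ
  have hΦ' (t : ℝ) : HasDerivAt Φ (-φ t) t := hasDerivAt_integral_Ioi hφc hφi t
  have hΦc : Continuous Φ := continuous_iff_continuousAt.2 fun t => (hΦ' t).continuousAt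
  have hΦ0 (t : ℝ) : 0 ≤ Φ t := integral_nonneg hφ0
  have hΦB (t : ℝ) : Φ t ≤ ∫ s, φ s :=
    setIntegral_le_integral hφi (ae_of_all _ hφ0)
  set e : ℝ → ℝ := fun t => Real.exp (2 * Φ t) with he
  have hec : Continuous e := by fun_prop
  have he0 (t : ℝ) : 0 < e t := Real.exp_pos _
  have he1 (t : ℝ) : 1 ≤ e t := Real.one_le_exp (by linarith [hΦ0 t])
  have hφei : Integrable fun t => φ t * e t := by
    refine hφi.mul_bdd (c := Real.exp (2 * ∫ s, φ s)) hec.aestronglyMeasurable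
      (ae_of_all _ fun t => ?_)
    rw [Real.norm_of_nonneg (he0 t).le]
    exact Real.exp_le_exp.2 (by linarith [hΦB t])
  have hint (t : ℝ) : ∫ s in Ioi t, φ s * e s = (e t - 1) / 2 := by
    have hd (s : ℝ) : HasDerivAt (fun s => -(e s) / 2) (φ s * e s) s :=
      (((hΦ' s).const_mul 2).exp.neg.div_const 2).congr_deriv (by simp only [he]; ring)
    have hl : Tendsto (fun s => -(e s) / 2) atTop (𝓝 (-1 / 2)) := by
      have := ((tendsto_integral_Ioi_atTop hφi).const_mul 2).rexp.neg.div_const 2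
      simpa using this
    rw [integral_Ioi_of_hasDerivAt_of_tendsto (hd t).continuousAt.continuousWithinAt
      (fun s _ => hd s) hφei.integrableOn hl]
    ring
  have hgc (y : BoundedContinuousFunction ℝ E) : Continuous fun s => F s (e s • y s) :=
    hF.comp (continuous_id.prodMk (hec.smul y.continuous))
  have hgd (y z : BoundedContinuousFunction ℝ E) (s : ℝ) :
      ‖F s (e s • y s) - F s (e s • z s)‖ ≤ φ s * e s * dist y z := by
    refine (hLip _ _ _).trans ?_
    rw [← smul_sub, norm_smul, Real.norm_of_nonneg (he0 s).le, mul_assoc, ← dist_eq_norm]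
    have := hφ0 s
    have := (he0 s).le
    gcongr
    exact BoundedContinuousFunction.dist_coe_le_dist s
  have hgn (y : BoundedContinuousFunction ℝ E) (s : ℝ) :
      ‖F s (e s • y s)‖ ≤ φ s * e s * dist y 0 := by
    simpa [hF0] using hgd y 0 s
  have hgi (y : BoundedContinuousFunction ℝ E) : Integrable fun s => F s (e s • y s) :=
    (hφei.mul_const _).mono' (hgc y).aestronglyMeasurable (ae_of_all _ (hgn y))
  have hTc (y : BoundedContinuousFunction ℝ E) :
      Continuous fun t => (e t)⁻¹ • (v - ∫ s in Ioi t, F s (e s • y s)) := by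
    have : Continuous fun t => ∫ s in Ioi t, F s (e s • y s) :=
      continuous_iff_continuousAt.2 fun t =>
        (hasDerivAt_integral_Ioi (hgc y) (hgi y) t).continuousAt
    exact (hec.inv₀ fun t => (he0 t).ne').smul (continuous_const.sub this)
  have key (t c : ℝ) (hc : 0 ≤ c) (g : ℝ → E) (hg : ∀ s, ‖g s‖ ≤ φ s * e s * c) :
      (e t)⁻¹ * ‖∫ s in Ioi t, g s‖ ≤ 1 / 2 * c := by
    have h1 : ‖∫ s in Ioi t, g s‖ ≤ ∫ s in Ioi t, φ s * e s * c :=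
      norm_integral_le_of_norm_le (hφei.mul_const c).integrableOn (ae_of_all _ hg)
    rw [integral_mul_const, hint] at h1
    rw [inv_mul_le_iff₀ (he0 t)]
    nlinarith
  have hTb (y : BoundedContinuousFunction ℝ E) (t : ℝ) :
      ‖(e t)⁻¹ • (v - ∫ s in Ioi t, F s (e s • y s))‖ ≤ ‖v‖ + 1 / 2 * dist y 0 := by
    rw [norm_smul, Real.norm_of_nonneg (inv_pos.2 (he0 t)).le]
    have h1 := key t _ dist_nonneg _ (hgn y)
    have h2 : (e t)⁻¹ * ‖v‖ ≤ ‖v‖ :=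
      mul_le_of_le_one_left (norm_nonneg _) (inv_le_one_of_one_le₀ (he1 t))
    have h3 := mul_le_mul_of_nonneg_left (norm_sub_le v (∫ s in Ioi t, F s (e s • y s)))
      (inv_pos.2 (he0 t)).le
    linarith
  let T : BoundedContinuousFunction ℝ E → BoundedContinuousFunction ℝ E := fun y =>
    .ofNormedAddCommGroup _ (hTc y) _ (hTb y)
  have hT : ContractingWith (1 / 2) T := by
    refine ⟨by rw [← NNReal.coe_lt_coe]; norm_num, LipschitzWith.of_dist_le_mul fun y z => ?_⟩
    have hb : 0 ≤ ((1 / 2 : NNReal) : ℝ) * dist y z := by positivity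
    refine (BoundedContinuousFunction.dist_le hb).2 fun t => ?_
    have h1 := key t _ dist_nonneg _ (hgd y z)
    rw [integral_sub (hgi y).integrableOn (hgi z).integrableOn] at h1
    change dist ((e t)⁻¹ • (v - ∫ s in Ioi t, F s (e s • y s)))
      ((e t)⁻¹ • (v - ∫ s in Ioi t, F s (e s • z s))) ≤ _
    rw [dist_eq_norm, ← smul_sub, norm_smul, Real.norm_of_nonneg (inv_pos.2 (he0 t)).le,
      sub_sub_sub_cancel_left, norm_sub_rev]
    simpa using h1
  obtain ⟨y, hy⟩ : ∃ y, T y = y := ⟨_, hT.fixedPoint_isFixedPt⟩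
  have hx (t : ℝ) : e t • y t = v - ∫ s in Ioi t, F s (e s • y s) := by
    conv_lhs => rw [← hy]
    exact smul_inv_smul₀ (he0 t).ne' _
  refine ⟨fun t => e t • y t, fun t => ?_, ?_⟩
  · have := (hasDerivAt_integral_Ioi (hgc y) (hgi y) t).const_sub v
    rw [neg_neg] at this
    exact this.congr_of_eventuallyEq (.of_forall hx)
  · rw [funext hx]
    simpa using (tendsto_integral_Ioi_atTop (hgi y)).const_sub v

end

section
open MeasureTheory Topology

/-- A function whose derivative decays like `t⁻²` converges at `+∞`. -/
theorem exists_tendsto_atTop_of_abs_deriv_le {g g' : ℝ → ℝ} {C : ℝ}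
    (hg : ∀ᶠ t in atTop, HasDerivAt g (g' t) t) (hC : ∀ᶠ t in atTop, |g' t| ≤ C / t ^ 2) :
    ∃ L, Tendsto g atTop (𝓝 L) := by
  obtain ⟨T, hT⟩ := eventually_atTop.1 ((hg.and hC).and (eventually_gt_atTop 0))
  have hT0 : 0 < T := (hT T le_rfl).2
  have hi : IntegrableOn (fun t : ℝ => C * t ^ (-2 : ℝ)) (Ioi T) :=
    (integrableOn_Ioi_rpow_of_lt (by norm_num) hT0).const_mul C
  have hd : EqOn (deriv g) g' (Ioi T) := fun t ht => (hT t (le_of_lt ht)).1.1.deriv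
  have hi' : IntegrableOn g' (Ioi T) := by
    refine Integrable.mono' hi ((aestronglyMeasurable_deriv g _).congr
      (ae_restrict_of_forall_mem measurableSet_Ioi hd)) ?_
    refine ae_restrict_of_forall_mem measurableSet_Ioi fun t ht => ?_
    refine (hT t (le_of_lt ht)).1.2.trans_eq ?_
    rw [Real.rpow_neg (hT0.trans ht).le, div_eq_mul_inv]
    norm_cast
  exact ⟨_, tendsto_limUnder_of_hasDerivAt_of_integrableOn_Ioi
    (fun t ht => (hT t (le_of_lt ht)).1.1) hi'⟩

/-- Comparison of coordinate time `t`, proper time `τ` and the tortoise coordinate `r`,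
with `dr/dt = (dτ/dt)² = (t² + l²) / (t² - l² + 2μt)`. -/
theorem properTime_asymptotics {l μ : ℝ} (hl : 0 < l) {τ r s : ℝ → ℝ}
    (hτ : ∀ᶠ t in atTop, HasDerivAt τ (s t) t)
    (hr : ∀ᶠ t in atTop, HasDerivAt r (s t ^ 2) t)
    (hs : ∀ᶠ t in atTop, 0 < s t ∧ s t ^ 2 = (t ^ 2 + l ^ 2) / (t ^ 2 - l ^ 2 + 2 * μ * t)) :
    Tendsto (fun t => τ t / t) atTop (𝓝 1) ∧
      ∃ L, Tendsto (fun t => r t - (τ t - μ * Real.log (τ t))) atTop (𝓝 L) := by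
  set C := 4 * l + 4 * |μ| with hC
  have hfl : ∀ᶠ t : ℝ in atTop, 0 < t ∧ l ≤ t ∧ t ^ 2 / 2 ≤ t ^ 2 - l ^ 2 + 2 * μ * t := by
    filter_upwards [eventually_ge_atTop (4 * |μ| + 2 * l)] with t ht
    have h1 := abs_nonneg μ
    have h2 := neg_abs_le μ
    have h3 : 0 < t := by linarith
    refine ⟨h3, by linarith, ?_⟩
    nlinarith [mul_le_mul_of_nonneg_right h2 h3.le, mul_le_mul_of_nonneg_right ht h3.le]
  have hs1 : ∀ᶠ t in atTop, (s t - 1) ^ 2 ≤ C ^ 2 / t ^ 2 := by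
    filter_upwards [hfl, hs] with t ⟨ht, hlt, hft⟩ ⟨hst, hst2⟩
    have hf0 : 0 < t ^ 2 - l ^ 2 + 2 * μ * t := lt_of_lt_of_le (by positivity) hft
    have h1 : |s t - 1| ≤ |s t ^ 2 - 1| := by
      rw [show s t ^ 2 - 1 = (s t - 1) * (s t + 1) by ring, abs_mul]
      exact le_mul_of_one_le_right (abs_nonneg _) (by rw [abs_of_pos] <;> linarith)
    have h2 : s t ^ 2 - 1 = (2 * l ^ 2 - 2 * μ * t) / (t ^ 2 - l ^ 2 + 2 * μ * t) := by
      rw [hst2, eq_div_iff hf0.ne', sub_mul, div_mul_cancel₀ _ hf0.ne']; ring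
    have h3 : |2 * l ^ 2 - 2 * μ * t| ≤ C * t / 2 := by
      have h4 := mul_le_mul_of_nonneg_right (neg_abs_le μ) ht.le
      have h5 := mul_le_mul_of_nonneg_right (le_abs_self μ) ht.le
      rw [abs_le]
      constructor <;> nlinarith
    have h4 : |s t ^ 2 - 1| ≤ C / t := by
      rw [h2, abs_div, abs_of_pos hf0, div_le_div_iff₀ hf0 ht]
      have hC0 : 0 ≤ C := by positivity
      nlinarith [mul_le_mul_of_nonneg_right h3 ht.le, mul_le_mul_of_nonneg_left hft hC0]
    rw [← div_pow, ← sq_abs]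
    exact pow_le_pow_left₀ (abs_nonneg _) (h1.trans h4) 2
  obtain ⟨L₁, hL₁⟩ : ∃ L, Tendsto (fun t => r t - 2 * τ t + t) atTop (𝓝 L) := by
    refine exists_tendsto_atTop_of_abs_deriv_le (g' := fun t => (s t - 1) ^ 2) ?_
      (hs1.mono fun t ht => by rwa [abs_of_nonneg (sq_nonneg _)])
    filter_upwards [hτ, hr] with t h1 h2
    exact ((h2.sub (h1.const_mul 2)).add (hasDerivAt_id t)).congr_deriv (by ring)
  obtain ⟨L₂, hL₂⟩ : ∃ L, Tendsto (fun t => τ t - t + μ * Real.log t) atTop (𝓝 L) := by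
    refine exists_tendsto_atTop_of_abs_deriv_le (g' := fun t => s t - 1 + μ * t⁻¹)
      (C := 2 * (l ^ 2 + |μ| * l + 2 * μ ^ 2) + C ^ 2 / 2) ?_ ?_
    · filter_upwards [hτ, eventually_gt_atTop 0] with t h1 h2
      exact (h1.sub (hasDerivAt_id t)).add ((Real.hasDerivAt_log h2.ne').const_mul μ)
    · filter_upwards [hfl, hs, hs1] with t ⟨ht, hlt, hft⟩ ⟨hst, hst2⟩ h1
      have hf0 : 0 < t ^ 2 - l ^ 2 + 2 * μ * t := lt_of_lt_of_le (by positivity) hft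
      have h2 : s t - 1 + μ * t⁻¹ = (l ^ 2 * t - μ * l ^ 2 + 2 * μ ^ 2 * t) /
          ((t ^ 2 - l ^ 2 + 2 * μ * t) * t) - (s t - 1) ^ 2 / 2 := by
        rw [show s t - 1 + μ * t⁻¹ = (s t ^ 2 - 1) / 2 + μ * t⁻¹ - (s t - 1) ^ 2 / 2 by ring,
          hst2]
        generalize hF : t ^ 2 - l ^ 2 + 2 * μ * t = F at hf0 ⊢
        field_simp
        rw [← hF]
        ring
      have h3 : |l ^ 2 * t - μ * l ^ 2 + 2 * μ ^ 2 * t| ≤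
          (l ^ 2 + |μ| * l + 2 * μ ^ 2) * t := by
        have h4 : |μ| * l * l ≤ |μ| * l * t := by gcongr
        have h5 := mul_le_mul_of_nonneg_right (neg_abs_le μ) (sq_nonneg l)
        have h6 := mul_le_mul_of_nonneg_right (le_abs_self μ) (sq_nonneg l)
        have h7 : 0 ≤ l ^ 2 * t := by positivity
        have h8 : 0 ≤ μ ^ 2 * t := by positivity
        rw [abs_le]
        constructor <;> nlinarith
      have h4 : |(l ^ 2 * t - μ * l ^ 2 + 2 * μ ^ 2 * t) /
          ((t ^ 2 - l ^ 2 + 2 * μ * t) * t)| ≤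
          2 * (l ^ 2 + |μ| * l + 2 * μ ^ 2) / t ^ 2 := by
        rw [abs_div, abs_of_pos (mul_pos hf0 ht)]
        calc _ ≤ (l ^ 2 + |μ| * l + 2 * μ ^ 2) * t / (t ^ 2 / 2 * t) := by gcongr
          _ = _ := by field_simp
      rw [h2, add_div _ _ (t ^ 2), div_right_comm (C ^ 2)]
      refine (abs_sub _ _).trans (add_le_add h4 ?_)
      rw [abs_of_nonneg (by positivity)]
      linarith
  have hlog : Tendsto (fun t => Real.log t / t) atTop (𝓝 0) :=
    Real.isLittleO_log_id_atTop.tendsto_div_nhds_zero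
  have hone : Tendsto (fun t => τ t / t) atTop (𝓝 1) := by
    have h := ((hL₂.mul tendsto_inv_atTop_zero).add_const 1).sub (hlog.const_mul μ)
    simp only [mul_zero, zero_add, sub_zero] at h
    refine h.congr' ?_
    filter_upwards [eventually_gt_atTop 0] with t ht
    field_simp
    ring
  refine ⟨hone, L₁ + L₂ + μ * 0, ?_⟩
  have h := hone.log one_ne_zero
  rw [Real.log_one] at h
  refine ((hL₁.add hL₂).add (h.const_mul μ)).congr' ?_
  filter_upwards [eventually_gt_atTop 0, hone.eventually (lt_mem_nhds one_pos)] with t ht h1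
  rw [Real.log_div (fun h0 => by simp [h0] at h1) ht.ne']
  ring

/-- The equation `w_rr + (κ² + V) w = 0` in the variable `r` with `dr/dt = ρ`, written as a
first-order system in `t` with `W = ρ V` integrable, has a solution asymptotic to
`exp (iκr)`. -/
theorem exists_solution_asymptotic_exp {ρ W r : ℝ → ℝ} {κ : ℝ} (hκ : κ ≠ 0)
    (hWc : Continuous W) (hWi : Integrable W) (hr : ∀ t, HasDerivAt r (ρ t) t) :
    ∃ w z : ℝ → ℂ, (∀ t, HasDerivAt w (ρ t * z t) t) ∧
      (∀ t, HasDerivAt z (-(W t + κ ^ 2 * ρ t) * w t) t) ∧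
      Tendsto (fun t => w t * Complex.exp (-(κ * r t : ℝ) * Complex.I)) atTop (𝓝 1) := by
  have hrc : Continuous r := continuous_iff_continuousAt.2 fun t => (hr t).continuousAt
  have hκ' : (κ : ℂ) ≠ 0 := by exact_mod_cast hκ
  set e : ℝ → ℂ := fun t => Complex.exp ((κ * r t : ℝ) * Complex.I) with he
  set e' : ℝ → ℂ := fun t => Complex.exp (-(κ * r t : ℝ) * Complex.I) with he'
  have hee (t : ℝ) : e t * e' t = 1 := by
    simp only [he, he', ← Complex.exp_add]; simp
  have hen (t : ℝ) : ‖e t‖ = 1 := Complex.norm_exp_ofReal_mul_I _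
  have hen' (t : ℝ) : ‖e' t‖ = 1 := by
    simpa [he'] using Complex.norm_exp_ofReal_mul_I (-(κ * r t))
  have hde (t : ℝ) : HasDerivAt e (Complex.I * κ * ρ t * e t) t :=
    ((((hr t).const_mul κ).ofReal_comp.mul_const Complex.I).cexp).congr_deriv (by
      simp only [he]; push_cast; ring)
  have hde' (t : ℝ) : HasDerivAt e' (-(Complex.I * κ * ρ t * e' t)) t :=
    ((((hr t).const_mul κ).ofReal_comp.neg.mul_const Complex.I).cexp).congr_deriv (by
      simp only [he', Pi.neg_apply]; push_cast; ring)
  have hec : Continuous e := by fun_prop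
  have hec' : Continuous e' := by fun_prop
  let F : ℝ → ℂ × ℂ → ℂ × ℂ := fun t x =>
    (-(W t / (2 * Complex.I * κ)) * (e' t * (x.1 * e t + x.2 * e' t)),
      W t / (2 * Complex.I * κ) * (e t * (x.1 * e t + x.2 * e' t)))
  have hFn (t : ℝ) (x : ℂ × ℂ) : ‖F t x‖ ≤ |W t| / |κ| * ‖x‖ := by
    have h1 : ‖x.1 * e t + x.2 * e' t‖ ≤ 2 * ‖x‖ := by
      refine (norm_add_le _ _).trans ?_
      rw [norm_mul, norm_mul, hen, hen']
      linarith [norm_fst_le x, norm_snd_le x]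
    have h2 : |W t| / (2 * |κ|) * ‖x.1 * e t + x.2 * e' t‖ ≤ |W t| / |κ| * ‖x‖ := by
      calc _ ≤ |W t| / (2 * |κ|) * (2 * ‖x‖) := by gcongr
        _ = _ := by field_simp
    refine max_le ?_ ?_ <;> simpa [F, hen, hen'] using h2
  obtain ⟨x, hx, hlim⟩ := exists_solution_tendsto_atTop (F := F) (φ := fun t => |W t| / |κ|)
    (by
      simp only [F, Function.uncurry_def]
      fun_prop)
    (by fun_prop) (hWi.abs.div_const _) (fun t => by simp [F])
    (fun t x y => by
      have h : F t x - F t y = F t (x - y) := by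
        ext1 <;> simp only [F, Prod.fst_sub, Prod.snd_sub] <;> ring
      exact h ▸ hFn t (x - y)) (1, 0)
  have hx1 (t : ℝ) : HasDerivAt (fun t => (x t).1) (F t (x t)).1 t :=
    (ContinuousLinearMap.fst ℝ ℂ ℂ).hasFDerivAt.comp_hasDerivAt t (hx t)
  have hx2 (t : ℝ) : HasDerivAt (fun t => (x t).2) (F t (x t)).2 t :=
    (ContinuousLinearMap.snd ℝ ℂ ℂ).hasFDerivAt.comp_hasDerivAt t (hx t)
  refine ⟨fun t => (x t).1 * e t + (x t).2 * e' t,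
    fun t => Complex.I * κ * ((x t).1 * e t - (x t).2 * e' t), fun t => ?_, fun t => ?_, ?_⟩
  · refine (((hx1 t).mul (hde t)).add ((hx2 t).mul (hde' t))).congr_deriv ?_
    simp only [F]
    ring
  · refine ((((hx1 t).mul (hde t)).sub ((hx2 t).mul (hde' t))).const_mul
      (Complex.I * κ)).congr_deriv ?_
    have h := hee t
    have hI := Complex.I_sq
    simp only [F]
    field_simp
    linear_combination (-2 * W t * ((x t).1 * e t + (x t).2 * e' t)) * h +
      (2 * κ ^ 2 * ρ t * ((x t).1 * e t + (x t).2 * e' t)) * hI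
  · have h1 : Tendsto (fun t => (x t).1) atTop (𝓝 1) := (continuous_fst.tendsto _).comp hlim
    have h2 : Tendsto (fun t => (x t).2) atTop (𝓝 0) := (continuous_snd.tendsto _).comp hlim
    have h3 : Tendsto (fun t => (x t).2 * e' t ^ 2) atTop (𝓝 0) :=
      squeeze_zero_norm (fun t => by simp [hen']) (tendsto_zero_iff_norm_tendsto_zero.1 h2)
    have h4 := h1.add h3
    rw [add_zero] at h4
    refine h4.congr fun t => ?_
    change _ = ((x t).1 * e t + (x t).2 * e' t) * e' t
    linear_combination (-(x t).1) * hee t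

end

section
open MeasureTheory Topology

theorem integrable_inv_sq_add_sq {l : ℝ} (hl : l ≠ 0) :
    Integrable fun t : ℝ => (t ^ 2 + l ^ 2)⁻¹ := by
  refine ((integrable_inv_one_add_sq.comp_div hl).mul_const (l ^ 2)⁻¹).congr
    (ae_of_all _ fun t => ?_)
  simp only
  rw [← mul_inv]
  congr 1
  field_simp
  ring

/-- The effective potential of the mode equation, after removing the leading phase. -/
def effectivePotential (l μ M t : ℝ) : ℝ :=
  M / (t ^ 2 + l ^ 2) -
    (5 * l ^ 2 * t ^ 2 - 2 * μ * t ^ 3 + 4 * μ * l ^ 2 * t - l ^ 4) / (t ^ 2 + l ^ 2) ^ 3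

theorem continuous_effectivePotential {l : ℝ} (hl : 0 < l) (μ M : ℝ) :
    Continuous (effectivePotential l μ M) := by
  have hq (t : ℝ) : t ^ 2 + l ^ 2 ≠ 0 := by positivity
  unfold effectivePotential
  fun_prop (disch := simp [hq])

theorem integrable_effectivePotential {l : ℝ} (hl : 0 < l) (μ M : ℝ) :
    Integrable (effectivePotential l μ M) := by
  refine ((integrable_inv_sq_add_sq hl.ne').const_mul (|M| + (6 + 3 * |μ| / l))).mono'
    (continuous_effectivePotential hl μ M).aestronglyMeasurable (ae_of_all _ fun t => ?_)
  have hq : 0 < t ^ 2 + l ^ 2 := by positivity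
  have h1 : |t| ≤ (t ^ 2 + l ^ 2) / (2 * l) := by
    rw [le_div_iff₀ (by positivity)]
    nlinarith [sq_nonneg (|t| - l), sq_abs t]
  have h2 : t ^ 2 ≤ t ^ 2 + l ^ 2 := by nlinarith
  have h3 : l ^ 2 ≤ t ^ 2 + l ^ 2 := by nlinarith
  have h4 : |5 * l ^ 2 * t ^ 2 - 2 * μ * t ^ 3 + 4 * μ * l ^ 2 * t - l ^ 4| ≤
      (6 + 3 * |μ| / l) * (t ^ 2 + l ^ 2) ^ 2 := by
    calc _ ≤ |5 * l ^ 2 * t ^ 2| + |2 * μ * t ^ 3| + |4 * μ * l ^ 2 * t| + |l ^ 4| :=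
          (abs_sub _ _).trans (add_le_add_left ((abs_add_le _ _).trans
            (add_le_add_left (abs_sub _ _) _)) _)
      _ = 5 * l ^ 2 * t ^ 2 + 2 * |μ| * (t ^ 2 * |t|) + 4 * |μ| * l ^ 2 * |t| + l ^ 2 * l ^ 2 := by
          have h5 : |t| ^ 3 = t ^ 2 * |t| := by rw [pow_succ, sq_abs]
          simp only [abs_mul, abs_pow, h5, sq_abs, abs_of_pos hl, Nat.abs_ofNat]
          ring
      _ ≤ 5 * (t ^ 2 + l ^ 2) * (t ^ 2 + l ^ 2)
          + 2 * |μ| * ((t ^ 2 + l ^ 2) * ((t ^ 2 + l ^ 2) / (2 * l)))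
          + 4 * |μ| * (t ^ 2 + l ^ 2) * ((t ^ 2 + l ^ 2) / (2 * l))
          + (t ^ 2 + l ^ 2) * (t ^ 2 + l ^ 2) := by gcongr
      _ = _ := by field_simp; ring
  rw [Real.norm_eq_abs]
  refine (abs_sub _ _).trans ?_
  rw [add_mul]
  refine add_le_add ?_ ?_
  · rw [abs_div, abs_of_pos hq, div_eq_mul_inv]
  · rw [abs_div, abs_of_pos (pow_pos hq 3), div_le_iff₀ (pow_pos hq 3)]
    refine h4.trans_eq ?_
    field_simp

/-- The Liouville substitution `ψ = w / √(t² + l²)` turns the first-order system for `(w, z)`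
into the mode equation. -/
theorem mode_equation_of_system {l μ M κ t₀ : ℝ} (hl : 0 < l) {f : ℝ → ℝ}
    (hf : ∀ t, f t = t ^ 2 - l ^ 2 + 2 * μ * t) (hf0 : ∀ t ≥ t₀, 0 < f t) {w z : ℝ → ℂ}
    (hw : ∀ t > t₀, HasDerivAt w (((t ^ 2 + l ^ 2) / f t : ℝ) * z t) t)
    (hz : ∀ t > t₀, HasDerivAt z (-(effectivePotential l μ M t +
      κ ^ 2 * ((t ^ 2 + l ^ 2) / f t : ℝ)) * w t) t) :
    let ψ : ℝ → ℂ := fun t => ((√(t ^ 2 + l ^ 2))⁻¹ : ℝ) * w t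
    ∀ t > t₀, DifferentiableAt ℝ ψ t ∧ DifferentiableAt ℝ (deriv ψ) t ∧
      deriv (deriv ψ) t + (deriv f t / f t : ℂ) * deriv ψ t +
        ((κ ^ 2 * ((t ^ 2 + l ^ 2) / f t) ^ 2 + M / f t : ℝ) : ℂ) * ψ t = 0 := by
  intro ψ
  have hq (t : ℝ) : 0 < t ^ 2 + l ^ 2 := by positivity
  set S : ℝ → ℝ := fun t => (√(t ^ 2 + l ^ 2))⁻¹ with hS
  have hS2 (t : ℝ) : S t ^ 2 * (t ^ 2 + l ^ 2) = 1 := by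
    simp only [hS, inv_pow, Real.sq_sqrt (hq t).le]
    exact inv_mul_cancel₀ (hq t).ne'
  have hqd (t : ℝ) : HasDerivAt (fun t : ℝ => t ^ 2 + l ^ 2) (2 * t) t := by
    simpa using (hasDerivAt_pow 2 t).add_const (l ^ 2)
  have hSd (t : ℝ) : HasDerivAt S (-t * S t ^ 3) t := by
    refine (((hqd t).sqrt (hq t).ne').inv (Real.sqrt_pos.2 (hq t)).ne').congr_deriv ?_
    have := (Real.sqrt_pos.2 (hq t)).ne'
    simp only [hS]
    field_simp
  have hfd (t : ℝ) : HasDerivAt f (2 * t + 2 * μ) t := by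
    rw [funext hf]
    exact (((hasDerivAt_pow 2 t).sub_const (l ^ 2)).add
      ((hasDerivAt_id t).const_mul (2 * μ))).congr_deriv (by simp)
  have hρd (t : ℝ) (ht : t > t₀) := (hqd t).div (hfd t) (hf0 t ht.le).ne'
  have hψ (t : ℝ) (ht : t > t₀) : HasDerivAt ψ ((-t * S t ^ 3 : ℝ) * w t +
      (S t : ℂ) * (((t ^ 2 + l ^ 2) / f t : ℝ) * z t)) t := (hSd t).ofReal_comp.mul (hw t ht)
  have hψ' (t : ℝ) (ht : t > t₀) :=
    ((((hasDerivAt_id t).neg.mul ((hSd t).pow 3)).ofReal_comp.mul (hw t ht)).add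
      ((hSd t).ofReal_comp.mul ((hρd t ht).ofReal_comp.mul (hz t ht)))).congr_of_eventuallyEq
      (f₁ := deriv ψ) (by
        filter_upwards [lt_mem_nhds ht] with s hs
        rw [(hψ s hs).deriv]
        simp)
  intro t ht
  refine ⟨(hψ t ht).differentiableAt, (hψ' t ht).differentiableAt, ?_⟩
  have hft := (hf0 t ht.le).ne'
  rw [(hψ' t ht).deriv, (hψ t ht).deriv, (hfd t).deriv]
  have h1 : (S t : ℂ) ^ 2 * (t ^ 2 + l ^ 2) = 1 := by exact_mod_cast hS2 t
  have h2 : (f t : ℂ) = t ^ 2 - l ^ 2 + 2 * μ * t := by exact_mod_cast hf t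
  have h3 : (f t : ℂ) ≠ 0 := by exact_mod_cast hft
  have h4 : (t : ℂ) ^ 2 + l ^ 2 ≠ 0 := by exact_mod_cast (hq t).ne'
  have h5 : (S t : ℂ) ^ 2 = 1 / (t ^ 2 + l ^ 2) := by rw [eq_div_iff h4, h1]
  have h6 : (S t : ℂ) ^ 3 = S t / (t ^ 2 + l ^ 2) := by rw [pow_succ, h5]; ring
  rw [show ψ t = S t * w t from rfl]
  simp only [effectivePotential, Pi.mul_apply, Pi.neg_apply, Pi.pow_apply, id, Pi.div_apply]
  push_cast
  simp only [h5, h6]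
  generalize hF : (f t : ℂ) = F at *
  generalize hQ : (t : ℂ) ^ 2 + l ^ 2 = Q at *
  field_simp
  rw [h2, ← hQ]
  ring

end

section
open Topology

theorem tendsto_mul_inv_sqrt_sq_add_sq (l : ℝ) :
    Tendsto (fun t => t * (√(t ^ 2 + l ^ 2))⁻¹) atTop (𝓝 1) := by
  have hq : Tendsto (fun t : ℝ => t ^ 2 + l ^ 2) atTop atTop :=
    tendsto_atTop_add_const_right _ _ (tendsto_pow_atTop two_ne_zero)
  have h := ((hq.inv_tendsto_atTop.const_mul (l ^ 2)).const_sub 1).sqrt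
  rw [mul_zero, sub_zero, Real.sqrt_one] at h
  refine h.congr' ?_
  filter_upwards [eventually_gt_atTop 0] with t ht
  have hq0 : 0 < t ^ 2 + l ^ 2 := by positivity
  rw [Pi.inv_apply, show 1 - l ^ 2 * (t ^ 2 + l ^ 2)⁻¹ = t ^ 2 / (t ^ 2 + l ^ 2) by field_simp; ring,
    Real.sqrt_div (sq_nonneg t), Real.sqrt_sq ht.le, div_eq_mul_inv]

/-- Differentiation of `∫ s in a..t, g s` at `t > a` when `g` is continuous on `[a, ∞)`. -/
theorem hasDerivAt_integral_of_continuousOn_Ici {g : ℝ → ℝ} {a t : ℝ}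
    (hg : ContinuousOn g (Ici a)) (ht : a < t) :
    HasDerivAt (fun t => ∫ s in a..t, g s) (g t) t := by
  have hc : Continuous fun s => g (max a s) :=
    hg.comp_continuous (by fun_prop) fun s => le_max_left a s
  refine (((hc.integral_hasStrictDerivAt a t).hasDerivAt).congr_deriv
    (by rw [max_eq_right ht.le])).congr_of_eventuallyEq ?_
  filter_upwards [lt_mem_nhds ht] with u hu
  refine intervalIntegral.integral_congr fun s hs => ?_
  rw [uIcc_of_le hu.le] at hs
  simp only [max_eq_right hs.1]

end

/-- Future asymptotics of generic (`m ≠ 0`) scalar-field modes on the LRS vacuum Bianchi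
VIII solution, expressed in proper time: the mode equation `ψ'' + (f'/f)ψ' + Z_m ψ = 0`
has fundamental solutions behaving, up to a nonzero constant factor, as
`τ⁻¹ e^{±i|m/(2l)|(τ − μ log τ)}(1 + o(1))` in the proper time `τ`.  Note the logarithmic
phase coefficient `−μ`, half of the coefficient `−2μ` of the coordinate-time expression. -/
theorem bianchiVIII_generic_mode_asymptotics_proper_time (l μ Λ : ℝ) (hl : 0 < l)
    (hΛ : 0 ≤ Λ) (m : ℤ) (hm : m ≠ 0)
    (f Z U : ℝ → ℝ)
    (hf : ∀ t, f t = t ^ 2 - l ^ 2 + 2 * μ * t)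
    (hZ : ∀ t, Z t = ((m : ℝ) ^ 2 / (4 * l ^ 2)) * ((t ^ 2 + l ^ 2) / f t) ^ 2 +
      ((m : ℝ) ^ 2 + Λ) / f t)
    (hU : ∀ t, U t = (t ^ 2 - l ^ 2 + 2 * μ * t) / (t ^ 2 + l ^ 2))
    (t₀ : ℝ) (hft₀ : ∀ t ≥ t₀, 0 < f t) (hUt₀ : ∀ t ≥ t₀, 0 < U t)
    (τ : ℝ → ℝ) (hτ : ∀ t, τ t = ∫ s in t₀..t, (U s) ^ (-(1 / 2 : ℝ)))
    (ε : ℝ) (hε : ε = 1 ∨ ε = -1) :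
    ∃ ψ : ℝ → ℂ,
      (∀ t ∈ Ioi t₀, DifferentiableAt ℝ ψ t ∧ DifferentiableAt ℝ (deriv ψ) t) ∧
      (∀ t ∈ Ioi t₀,
        deriv (deriv ψ) t + (deriv f t / f t : ℂ) * deriv ψ t + (Z t : ℂ) * ψ t = 0) ∧
      ∃ c : ℂ, c ≠ 0 ∧
        Tendsto (fun t : ℝ => ψ t * ((τ t : ℝ) : ℂ) *
            Complex.exp (-(ε : ℂ) * Complex.I * ((|(m : ℝ)| / (2 * l) : ℝ) : ℂ) *
              (((τ t : ℝ) : ℂ) - (μ : ℂ) * ((Real.log (τ t) : ℝ) : ℂ))))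
          atTop (nhds c) := by
  have hq (t : ℝ) : 0 < t ^ 2 + l ^ 2 := by positivity
  have hfc : Continuous f := by rw [funext hf]; fun_prop
  have hUf (t : ℝ) : U t = f t / (t ^ 2 + l ^ 2) := by rw [hU, hf]
  have hUc : Continuous U := by
    rw [funext hUf]
    exact hfc.div (by fun_prop) fun t => (hq t).ne'
  have hτd (t : ℝ) (ht : t₀ < t) : HasDerivAt τ (U t ^ (-(1 / 2 : ℝ))) t := by
    rw [funext hτ]
    exact hasDerivAt_integral_of_continuousOn_Ici
      (hUc.continuousOn.rpow_const fun s hs => .inl (hUt₀ s hs).ne') ht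
  set ρ : ℝ → ℝ := fun t => ((max t₀ t) ^ 2 + l ^ 2) / f (max t₀ t) with hρ
  have hρc : Continuous ρ := by
    refine Continuous.div (by fun_prop) (by fun_prop) fun t => (hft₀ _ (le_max_left _ _)).ne'
  have hρt (t : ℝ) (ht : t₀ < t) : ρ t = (t ^ 2 + l ^ 2) / f t := by
    simp only [hρ, max_eq_right ht.le]
  set r : ℝ → ℝ := fun t => ∫ s in t₀..t, ρ s
  have hr (t : ℝ) : HasDerivAt r (ρ t) t := (hρc.integral_hasStrictDerivAt t₀ t).hasDerivAt
  have hs (t : ℝ) (ht : t₀ < t) : (U t ^ (-(1 / 2 : ℝ))) ^ 2 = (t ^ 2 + l ^ 2) / f t := by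
    have hU0 := hUt₀ t ht.le
    rw [← Real.rpow_natCast, ← Real.rpow_mul hU0.le, ← inv_div (f t), ← hUf, ← Real.rpow_neg_one]
    norm_num
  obtain ⟨hτ1, L, hL⟩ := properTime_asymptotics (μ := μ) (r := r) hl
    ((eventually_gt_atTop t₀).mono hτd)
    ((eventually_gt_atTop t₀).mono fun t ht => by
      rw [hs t ht, ← hρt t ht]
      exact hr t)
    ((eventually_gt_atTop t₀).mono fun t ht => ⟨Real.rpow_pos_of_pos (hUt₀ t ht.le) _, by
      rw [hs t ht, hf t]⟩)
  set κ : ℝ := ε * (|(m : ℝ)| / (2 * l)) with hκ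
  have hm' : (m : ℝ) ≠ 0 := by exact_mod_cast hm
  have hε2 : ε ^ 2 = 1 := by rcases hε with rfl | rfl <;> norm_num
  have hε0 : ε ≠ 0 := fun h => by simp [h] at hε2
  have hκ0 : κ ≠ 0 := by positivity
  have hκ2 : κ ^ 2 = (m : ℝ) ^ 2 / (4 * l ^ 2) := by
    rw [hκ, mul_pow, hε2, div_pow, sq_abs]
    ring
  obtain ⟨w, z, hw, hz, hlim⟩ := exists_solution_asymptotic_exp hκ0
    (continuous_effectivePotential hl μ ((m : ℝ) ^ 2 + Λ))
    (integrable_effectivePotential hl μ ((m : ℝ) ^ 2 + Λ)) hr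
  have hψ := mode_equation_of_system hl hf hft₀ (w := w) (z := z) (κ := κ)
    (fun t ht => hρt t ht ▸ hw t) (fun t ht => hρt t ht ▸ hz t)
  refine ⟨_, fun t ht => ⟨(hψ t ht).1, (hψ t ht).2.1⟩, fun t ht => ?_,
    Complex.exp ((κ * L : ℝ) * Complex.I), Complex.exp_ne_zero _, ?_⟩
  · rw [hZ, ← hκ2]
    exact (hψ t ht).2.2
  · have h1 : Tendsto (fun t => τ t * (√(t ^ 2 + l ^ 2))⁻¹) atTop (nhds 1) := by
      have h := hτ1.mul (tendsto_mul_inv_sqrt_sq_add_sq l)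
      rw [mul_one] at h
      refine h.congr' ?_
      filter_upwards [eventually_gt_atTop 0] with t ht
      field_simp
    have h2 : Tendsto (fun t => Complex.exp
        ((κ * (r t - (τ t - μ * Real.log (τ t))) : ℝ) * Complex.I)) atTop
        (nhds (Complex.exp ((κ * L : ℝ) * Complex.I))) :=
      (((Complex.continuous_ofReal.tendsto _).comp (hL.const_mul κ)).mul_const Complex.I).cexp
    have h3 := (((Complex.continuous_ofReal.tendsto _).comp h1).mul hlim).mul h2
    rw [Complex.ofReal_one, one_mul, one_mul] at h3
    refine h3.congr fun t => ?_
    have h4 : Complex.exp (-(ε : ℂ) * Complex.I * ((|(m : ℝ)| / (2 * l) : ℝ) : ℂ) *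
        (((τ t : ℝ) : ℂ) - (μ : ℂ) * ((Real.log (τ t) : ℝ) : ℂ))) =
        Complex.exp (-(κ * r t : ℝ) * Complex.I) *
          Complex.exp ((κ * (r t - (τ t - μ * Real.log (τ t))) : ℝ) * Complex.I) := by
      rw [← Complex.exp_add, hκ]
      congr 1
      push_cast
      ring
    rw [h4]
    simp only [Function.comp_apply]
    push_cast
    ring
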